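/- arXiv:1308.0727 — 2 statements merged into one kernel-verified Lean document; each statement's English description precedes it below -/
import Mathlib

section
/- Assume π has nilpotency 2 (π^2 = 0, π ≠ 0). Let r, b_{01} ∈ R[x] with r̄ irreducible in F[x], let e_0 ≥ e_1 ≥ 0 be integers with e_0 > 0, and let I be an ideal of R[x] with canonical sequence (f_0, f_1) where f_1 = r^{e_1} and f_0 = r^{e_0} + π b_{01}. Then: (i) if e_1 = 0 or e_1 = e_0, then R[x]/I is Frobenius and local; (ii) if e_0 > e_1 > 0, then R[x]/I is Frobenius and local if and only if r̄ does not divide b̄_{01} in F[x]. -/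
open Polynomial

/-- A commutative ring `S` is *Frobenius* if it is artinian and `S/rad(S)` is isomorphic,
as an `S`-module, to the socle of `S` (the sum of all minimal ideals of `S`). -/
def IsFrobeniusRing (S : Type*) [CommRing S] : Prop :=
  IsArtinianRing S ∧
    Nonempty ((S ⧸ Ideal.jacobson (⊥ : Ideal S)) ≃ₗ[S]
      (sSup {J : Ideal S | IsAtom J} : Ideal S))

/-- The reduction map `R[x] → (R/πR)[x]`. -/
noncomputable def redMod {R : Type*} [CommRing R] (π : R) :
    R[X] →+* (R ⧸ Ideal.span {π})[X] :=
  Polynomial.mapRingHom (Ideal.Quotient.mk (Ideal.span {π}))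

/-- `(f 0, …, f (n-1))` is a canonical sequence of the ideal `I` of `R[x]`. -/
def IsCanonicalSequence {R : Type*} [CommRing R] (π : R) (n : ℕ)
    (I : Ideal R[X]) (f : ℕ → R[X]) : Prop :=
  ∀ i < n, (C π ^ i * f i ∈ I) ∧
    ∀ g : R[X], C π ^ i * g ∈ I →
      redMod π g = 0 ∨ (redMod π (f i) ≠ 0 ∧ (redMod π (f i)).degree ≤ (redMod π g).degree)

theorem exists_pow_eq_mul_add_of_not_dvd {D : Type*} [CommRing D] [IsDomain D]
    [IsPrincipalIdealRing D] {q a : D} (hq : Irreducible q) {k : ℕ} (h : ¬ q ^ (k + 1) ∣ a) :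
    ∃ u v, q ^ k = u * a + v * q ^ (k + 1) := by
  obtain ⟨d, hd⟩ := IsPrincipalIdealRing.principal (Ideal.span {a, q ^ (k + 1)})
  rw [Ideal.submodule_span_eq] at hd
  have hda : d ∣ a := Ideal.mem_span_singleton.1 (hd ▸ Ideal.subset_span (by simp))
  have hdq : d ∣ q ^ (k + 1) := Ideal.mem_span_singleton.1 (hd ▸ Ideal.subset_span (by simp))
  obtain ⟨i, hi, hdi⟩ := (dvd_prime_pow hq.prime _).1 hdq
  have hik : i ≤ k := by
    by_contra hcon
    obtain rfl : i = k + 1 := by omega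
    exact h (hdi.symm.dvd.trans hda)
  have hmem : q ^ k ∈ Ideal.span {a, q ^ (k + 1)} :=
    hd ▸ Ideal.mem_span_singleton.2 (hdi.dvd.trans (pow_dvd_pow q hik))
  obtain ⟨u, v, huv⟩ := Ideal.mem_span_pair.1 hmem
  exact ⟨u, v, huv.symm⟩

theorem isFrobeniusRing_of_forall_dvd {S : Type*} [CommRing S] [IsLocalRing S]
    [IsArtinianRing S] {s : S} (hs : s ≠ 0) (h : ∀ t, t ≠ 0 → t ∣ s) : IsFrobeniusRing S := by
  refine ⟨inferInstance, ?_⟩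
  have hle (J : Ideal S) (hJ : J ≠ ⊥) : Ideal.span {s} ≤ J := by
    obtain ⟨t, htJ, ht⟩ := Submodule.exists_mem_ne_zero_of_ne_bot hJ
    exact (Ideal.span_singleton_le_iff_mem J).2 (J.mem_of_dvd (h t ht) htJ)
  have hbot : Ideal.span {s} ≠ ⊥ := by simpa using hs
  have hatom : IsAtom (Ideal.span {s}) :=
    ⟨hbot, fun J hJ => by_contra fun hJ0 => hJ.not_ge (hle J hJ0)⟩
  have hsoc : sSup {J : Ideal S | IsAtom J} = Ideal.span {s} :=
    le_antisymm
      (sSup_le fun J hJ => ((hJ.le_iff.1 (hle J hJ.1)).resolve_left hbot).ge)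
      (le_sSup hatom)
  have hker : LinearMap.ker (LinearMap.toSpanSingleton S S s) = Ideal.jacobson ⊥ := by
    rw [IsLocalRing.jacobson_eq_maximalIdeal _ bot_ne_top]
    refine le_antisymm (IsLocalRing.le_maximalIdeal ?_) fun m hm => ?_
    · intro htop
      exact hs (by simpa using (htop ▸ Submodule.mem_top :
        (1 : S) ∈ LinearMap.ker (LinearMap.toSpanSingleton S S s)))
    · rw [LinearMap.mem_ker, LinearMap.toSpanSingleton_apply, smul_eq_mul]
      by_contra hms
      obtain ⟨c, hc⟩ := h _ hms
      have hu : IsUnit (1 - m * c) :=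
        IsLocalRing.isUnit_one_sub_self_of_mem_nonunits _
          ((IsLocalRing.mem_maximalIdeal _).1 (Ideal.mul_mem_right c _ hm))
      exact hs (hu.mul_right_eq_zero.1 (by linear_combination hc))
  rw [hsoc]
  exact ⟨(Submodule.quotEquivOfEq _ _ hker.symm).trans
    ((LinearMap.toSpanSingleton S S s).quotKerEquivRange.trans
      (LinearEquiv.ofEq _ _ (LinearMap.range_toSpanSingleton s)))⟩

theorem isAtom_span_singleton_of_maximalIdeal_mul {S : Type*} [CommRing S] [IsLocalRing S]
    {a : S} (ha : a ≠ 0) (h : ∀ m ∈ IsLocalRing.maximalIdeal S, m * a = 0) :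
    IsAtom (Ideal.span {a}) := by
  refine ⟨by simpa using ha, fun J hJ => by_contra fun hJ0 => hJ.not_ge ?_⟩
  obtain ⟨t, htJ, ht⟩ := Submodule.exists_mem_ne_zero_of_ne_bot hJ0
  obtain ⟨c, rfl⟩ := Ideal.mem_span_singleton'.1 (hJ.le htJ)
  have hc : IsUnit c := by
    by_contra hc
    exact ht (h c ((IsLocalRing.mem_maximalIdeal c).2 hc))
  exact (Ideal.span_singleton_le_iff_mem J).2 ((Ideal.unit_mul_mem_iff_mem J hc).1 htJ)

theorem IsFrobeniusRing.dvd_of_maximalIdeal_mul {S : Type*} [CommRing S] [IsLocalRing S]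
    (hS : IsFrobeniusRing S) {a b : S} (ha : a ≠ 0)
    (hMa : ∀ m ∈ IsLocalRing.maximalIdeal S, m * a = 0) (hb : b ≠ 0)
    (hMb : ∀ m ∈ IsLocalRing.maximalIdeal S, m * b = 0) : a ∣ b := by
  obtain ⟨-, ⟨e⟩⟩ := hS
  rw [IsLocalRing.jacobson_eq_maximalIdeal _ bot_ne_top] at e
  have hsimple : IsSimpleModule S (S ⧸ IsLocalRing.maximalIdeal S) :=
    isSimpleModule_iff_isCoatom.2 (IsLocalRing.maximalIdeal.isMaximal S).out
  have hsoc := isSimpleModule_iff_isAtom.1 (IsSimpleModule.congr e.symm)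
  have hle {c : S} (hc : c ≠ 0) (hMc : ∀ m ∈ IsLocalRing.maximalIdeal S, m * c = 0) :
      Ideal.span {c} = sSup {J : Ideal S | IsAtom J} :=
    (hsoc.le_iff.1 (le_sSup (isAtom_span_singleton_of_maximalIdeal_mul hc hMc))).resolve_left
      (by simpa using hc)
  rw [← Ideal.mem_span_singleton, hle ha hMa, ← hle hb hMb]
  exact Ideal.mem_span_singleton_self b

/-- An ideal `I` of `P`, described through a surjection `φ` from `P` onto a principal ideal
domain whose kernel is generated by an element `p` of square zero: the image of `I` is
contained in `(φ r ^ e0)`, and `{φ g | p * g ∈ I}` is `(φ r ^ e1)`. -/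
structure IsPrimaryLayer {P D : Type*} [CommRing P] [CommRing D] (φ : P →+* D) (p r b : P)
    (e0 e1 : ℕ) (I : Ideal P) : Prop where
  of ::
  surjective : Function.Surjective φ
  eq_zero_iff : ∀ g, φ g = 0 ↔ p ∣ g
  sq_eq_zero : p * p = 0
  irreducible : Irreducible (φ r)
  pos : 0 < e0
  mem : r ^ e0 + p * b ∈ I
  dvd_of_mem : ∀ g ∈ I, φ r ^ e0 ∣ φ g
  mul_mem_iff : ∀ g, p * g ∈ I ↔ φ r ^ e1 ∣ φ g

namespace IsPrimaryLayer

open Ideal.Quotient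

variable {P D : Type*} [CommRing P] [CommRing D] {φ : P →+* D} {p r b : P} {e0 e1 : ℕ}
  {I : Ideal P}

theorem exists_eq_add (h : IsPrimaryLayer φ p r b e0 e1 I) {g g' : P} (hg : φ g = φ g') :
    ∃ z, g = g' + p * z := by
  obtain ⟨z, hz⟩ := (h.eq_zero_iff (g - g')).1 (by rw [map_sub, hg, sub_self])
  exact ⟨z, by linear_combination hz⟩

theorem mk_mul_self (h : IsPrimaryLayer φ p r b e0 e1 I) : mk I p * mk I p = 0 := by
  rw [← map_mul, h.sq_eq_zero, map_zero]

theorem mk_pow (h : IsPrimaryLayer φ p r b e0 e1 I) : mk I r ^ e0 + mk I p * mk I b = 0 := by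
  simpa using eq_zero_iff_mem.2 h.mem

theorem mk_mul_pow (h : IsPrimaryLayer φ p r b e0 e1 I) : mk I p * mk I r ^ e1 = 0 := by
  simpa using eq_zero_iff_mem.2 ((h.mul_mem_iff (r ^ e1)).2 (by simp))

theorem nontrivial (h : IsPrimaryLayer φ p r b e0 e1 I) : Nontrivial (P ⧸ I) := by
  refine Ideal.Quotient.nontrivial_iff.2 fun htop => h.irreducible.not_isUnit ?_
  have h1 := h.dvd_of_mem 1 (htop ▸ Submodule.mem_top)
  rw [map_one] at h1
  exact isUnit_of_dvd_one ((dvd_pow_self _ h.pos.ne').trans h1)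

theorem isNilpotent_mk (h : IsPrimaryLayer φ p r b e0 e1 I) {g : P} (hg : φ r ∣ φ g) :
    IsNilpotent (mk I g) := by
  obtain ⟨c, hc⟩ := hg
  obtain ⟨w, rfl⟩ := h.surjective c
  obtain ⟨z, rfl⟩ := h.exists_eq_add (hc.trans (map_mul φ r w).symm)
  have hp : IsNilpotent (mk I p) := ⟨2, by rw [sq, h.mk_mul_self]⟩
  have hr : IsNilpotent (mk I r) := by
    refine IsNilpotent.of_pow (m := e0) ?_
    rw [eq_neg_of_add_eq_zero_left h.mk_pow, isNilpotent_neg_iff]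
    exact (Commute.all _ _).isNilpotent_mul_right hp
  rw [map_add, map_mul, map_mul]
  exact (Commute.all _ _).isNilpotent_add ((Commute.all _ _).isNilpotent_mul_right hr)
    ((Commute.all _ _).isNilpotent_mul_right hp)

/-- An element of `P ⧸ I` whose image is divisible by `φ r ^ e0` is a multiple of `p`. -/
theorem exists_mk_eq_mul (h : IsPrimaryLayer φ p r b e0 e1 I) {t : P} (ht : φ r ^ e0 ∣ φ t) :
    ∃ w, mk I t = mk I p * mk I w := by
  obtain ⟨c, hc⟩ := ht
  obtain ⟨c, rfl⟩ := h.surjective c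
  obtain ⟨z, hz⟩ := h.exists_eq_add (g := t) (g' := r ^ e0 * c) (by simpa using hc)
  refine ⟨z - b * c, ?_⟩
  rw [hz]
  simp only [map_sub, map_add, map_mul, map_pow]
  linear_combination mk I c * h.mk_pow

variable [IsDomain D]

theorem mk_mul_pow_ne_zero (h : IsPrimaryLayer φ p r b e0 e1 I) {k : ℕ} (hk : e1 = k + 1) :
    mk I p * mk I r ^ k ≠ 0 := by
  rw [← map_pow, ← map_mul, Ne, eq_zero_iff_mem, h.mul_mem_iff, map_pow, hk]
  exact fun hd => absurd ((pow_dvd_pow_iff h.irreducible.ne_zero h.irreducible.not_isUnit).1 hd)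
    (by omega)

theorem mk_pow_add_ne_zero (h : IsPrimaryLayer φ p r b e0 e1 I) {k : ℕ} (hk : e0 = k + 1)
    (z : P) : mk I r ^ k + mk I p * mk I z ≠ 0 := by
  rw [← map_pow, ← map_mul, ← map_add, Ne, eq_zero_iff_mem]
  intro hmem
  have hd := h.dvd_of_mem _ hmem
  rw [map_add, map_mul, (h.eq_zero_iff p).2 dvd_rfl, zero_mul, add_zero, map_pow, hk] at hd
  exact absurd ((pow_dvd_pow_iff h.irreducible.ne_zero h.irreducible.not_isUnit).1 hd) (by omega)

variable [IsPrincipalIdealRing D]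

theorem isUnit_mk_iff (h : IsPrimaryLayer φ p r b e0 e1 I) {g : P} :
    IsUnit (mk I g) ↔ ¬ φ r ∣ φ g := by
  have := h.nontrivial
  refine ⟨fun hu hg => hu.not_isNilpotent (h.isNilpotent_mk hg), fun hg => ?_⟩
  obtain ⟨u, v, huv⟩ := exists_pow_eq_mul_add_of_not_dvd (k := 0) h.irreducible (by simpa using hg)
  obtain ⟨u, rfl⟩ := h.surjective u
  obtain ⟨v, rfl⟩ := h.surjective v
  have hn : IsNilpotent (mk I (1 - u * g)) :=
    h.isNilpotent_mk ⟨φ v, by simp only [map_sub, map_one, map_mul]; linear_combination huv⟩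
  have hu := hn.isUnit_one_sub
  rw [map_sub, map_one, sub_sub_cancel, map_mul] at hu
  exact isUnit_of_mul_isUnit_right hu

theorem isLocalRing (h : IsPrimaryLayer φ p r b e0 e1 I) : IsLocalRing (P ⧸ I) := by
  have := h.nontrivial
  refine IsLocalRing.of_nonunits_add fun x y hx hy => ?_
  obtain ⟨x, rfl⟩ := mk_surjective x
  obtain ⟨y, rfl⟩ := mk_surjective y
  rw [mem_nonunits_iff, h.isUnit_mk_iff, not_not] at hx hy
  rw [mem_nonunits_iff, ← map_add, h.isUnit_mk_iff, not_not, map_add]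
  exact dvd_add hx hy

theorem mk_mem_maximalIdeal_iff (h : IsPrimaryLayer φ p r b e0 e1 I) [IsLocalRing (P ⧸ I)]
    {g : P} : mk I g ∈ IsLocalRing.maximalIdeal (P ⧸ I) ↔ φ r ∣ φ g := by
  rw [IsLocalRing.mem_maximalIdeal, mem_nonunits_iff, h.isUnit_mk_iff, not_not]

theorem isArtinianRing (h : IsPrimaryLayer φ p r b e0 e1 I) [IsNoetherianRing P] :
    IsArtinianRing (P ⧸ I) := by
  have := h.isLocalRing
  refine (isArtinianRing_iff_isNilpotent_maximalIdeal _).2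
    ((Ideal.FG.isNilpotent_iff_le_nilradical (IsNoetherian.noetherian _)).2 fun x hx => ?_)
  obtain ⟨x, rfl⟩ := mk_surjective x
  exact h.isNilpotent_mk (h.mk_mem_maximalIdeal_iff.1 hx)

theorem maximalIdeal_mul_eq_zero (h : IsPrimaryLayer φ p r b e0 e1 I) [IsLocalRing (P ⧸ I)]
    {a : P ⧸ I} (hp : mk I p * a = 0) (hr : mk I r * a = 0) :
    ∀ m ∈ IsLocalRing.maximalIdeal (P ⧸ I), m * a = 0 := by
  intro m hm
  obtain ⟨g, rfl⟩ := mk_surjective m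
  obtain ⟨c, hc⟩ := h.mk_mem_maximalIdeal_iff.1 hm
  obtain ⟨w, rfl⟩ := h.surjective c
  obtain ⟨z, rfl⟩ := h.exists_eq_add (hc.trans (map_mul φ r w).symm)
  simp only [map_add, map_mul]
  linear_combination mk I w * hr + mk I z * hp

/-- If the image of `t` is not divisible by `φ r ^ e0`, then some multiple of `t` agrees
with `r ^ (e0 - 1)` up to a multiple of `p`. -/
theorem exists_mul_eq_pow_add (h : IsPrimaryLayer φ p r b e0 e1 I) {t : P} {k : ℕ}
    (hk : e0 = k + 1) (ht : ¬ φ r ^ e0 ∣ φ t) :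
    ∃ u z, mk I u * mk I t = mk I r ^ k + mk I p * mk I z := by
  have hpow := h.mk_pow
  subst hk
  obtain ⟨u, v, huv⟩ := exists_pow_eq_mul_add_of_not_dvd h.irreducible ht
  obtain ⟨u, rfl⟩ := h.surjective u
  obtain ⟨v, rfl⟩ := h.surjective v
  obtain ⟨z, hz⟩ := h.exists_eq_add (g := r ^ k) (g' := u * t + v * r ^ (k + 1)) (by simpa using huv)
  have hz' := congrArg (mk I) hz
  simp only [map_add, map_mul, map_pow] at hz'
  refine ⟨u, v * b - z, ?_⟩
  simp only [map_sub, map_mul]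
  linear_combination -hz' - mk I v * hpow

theorem mk_mul_dvd (h : IsPrimaryLayer φ p r b e0 e1 I) {w : P} {k : ℕ} (hk : e1 = k + 1)
    (hw : ¬ φ r ^ e1 ∣ φ w) : mk I p * mk I w ∣ mk I p * mk I r ^ k := by
  have hpow := h.mk_mul_pow
  subst hk
  obtain ⟨u, v, huv⟩ := exists_pow_eq_mul_add_of_not_dvd h.irreducible hw
  obtain ⟨u, rfl⟩ := h.surjective u
  obtain ⟨v, rfl⟩ := h.surjective v
  obtain ⟨z, hz⟩ := h.exists_eq_add (g := r ^ k) (g' := u * w + v * r ^ (k + 1)) (by simpa using huv)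
  have hz' := congrArg (mk I) hz
  simp only [map_add, map_mul, map_pow] at hz'
  exact ⟨mk I u, by linear_combination mk I p * hz' + mk I v * hpow + mk I z * h.mk_mul_self⟩

theorem isFrobeniusRing_of_eq_zero (h : IsPrimaryLayer φ p r b e0 e1 I) [IsNoetherianRing P]
    (he : e1 = 0) : IsFrobeniusRing (P ⧸ I) := by
  have := h.isLocalRing
  have := h.isArtinianRing
  obtain ⟨k, hk⟩ := Nat.exists_eq_add_one.2 h.pos
  have hp : mk I p = 0 := by simpa [he] using h.mk_mul_pow
  refine isFrobeniusRing_of_forall_dvd (s := mk I r ^ k)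
    (by simpa using h.mk_pow_add_ne_zero hk 0) fun t ht => ?_
  obtain ⟨t, rfl⟩ := mk_surjective t
  by_cases hd : φ r ^ e0 ∣ φ t
  · obtain ⟨w, hw⟩ := h.exists_mk_eq_mul hd
    exact absurd (by rw [hw, hp, zero_mul]) ht
  · obtain ⟨u, z, huz⟩ := h.exists_mul_eq_pow_add hk hd
    exact ⟨mk I u, by linear_combination -huz - mk I z * hp⟩

theorem isFrobeniusRing_of_pos (h : IsPrimaryLayer φ p r b e0 e1 I) [IsNoetherianRing P]
    (he : 0 < e1) (hb : e1 = e0 ∨ ¬ φ r ∣ φ b) : IsFrobeniusRing (P ⧸ I) := by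
  have := h.isLocalRing
  have := h.isArtinianRing
  obtain ⟨k, hk⟩ := Nat.exists_eq_add_one.2 h.pos
  obtain ⟨l, hl⟩ := Nat.exists_eq_add_one.2 he
  refine isFrobeniusRing_of_forall_dvd (h.mk_mul_pow_ne_zero hl) fun t ht => ?_
  obtain ⟨t, rfl⟩ := mk_surjective t
  by_cases hd : φ r ^ e0 ∣ φ t
  · obtain ⟨w, hw⟩ := h.exists_mk_eq_mul hd
    rw [hw] at ht ⊢
    refine h.mk_mul_dvd hl fun hdw => ht ?_
    rw [← map_mul]
    exact eq_zero_iff_mem.2 ((h.mul_mem_iff w).2 hdw)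
  · obtain ⟨u, z, huz⟩ := h.exists_mul_eq_pow_add hk hd
    rcases hb with rfl | hb
    · obtain rfl : k = l := by omega
      exact ⟨mk I p * mk I u, by linear_combination -mk I p * huz - mk I z * h.mk_mul_self⟩
    · have hrz : mk I t ∣ mk I p * mk I (r * z - b) := by
        have hpow := h.mk_pow
        rw [hk] at hpow
        refine ⟨mk I r * mk I u, ?_⟩
        simp only [map_sub, map_mul]
        linear_combination -mk I r * huz - hpow
      refine hrz.trans (h.mk_mul_dvd hl fun hd' => hb ?_)
      have h1 := (dvd_pow_self (φ r) he.ne').trans hd'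
      rw [map_sub, map_mul] at h1
      exact (dvd_sub_right (dvd_mul_right _ _)).1 h1

theorem not_dvd_of_isFrobeniusRing (h : IsPrimaryLayer φ p r b e0 e1 I) (he : 0 < e1)
    (hlt : e1 < e0) (hF : IsFrobeniusRing (P ⧸ I)) : ¬ φ r ∣ φ b := by
  rintro ⟨c, hc⟩
  obtain ⟨c, rfl⟩ := h.surjective c
  obtain ⟨y, hy⟩ := h.exists_eq_add (g := b) (g' := r * c) (by simpa using hc)
  have := h.isLocalRing
  obtain ⟨k, hk⟩ := Nat.exists_eq_add_one.2 h.pos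
  obtain ⟨l, hl⟩ := Nat.exists_eq_add_one.2 he
  have hpp := h.mk_mul_self
  have hpr := h.mk_mul_pow
  have hpow := h.mk_pow
  have hy' := congrArg (mk I) hy
  simp only [map_add, map_mul] at hy'
  have hpk : mk I p * mk I r ^ k = 0 := by
    obtain ⟨j, rfl⟩ : ∃ j, k = e1 + j := ⟨k - e1, by omega⟩
    rw [pow_add, ← mul_assoc, hpr, zero_mul]
  obtain ⟨x, hx⟩ := hF.dvd_of_maximalIdeal_mul (h.mk_mul_pow_ne_zero hl)
    (h.maximalIdeal_mul_eq_zero (by linear_combination mk I r ^ l * hpp)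
      (by rw [hl] at hpr; linear_combination hpr))
    (h.mk_pow_add_ne_zero hk c)
    (h.maximalIdeal_mul_eq_zero (by linear_combination hpk + mk I c * hpp)
      (by rw [hk] at hpow; linear_combination hpow - mk I p * hy' - mk I y * hpp))
  obtain ⟨x, rfl⟩ := mk_surjective x
  refine h.mk_pow_add_ne_zero hk (c - r ^ l * x) ?_
  simp only [map_sub, map_mul, map_pow]
  linear_combination hx

end IsPrimaryLayer

theorem redMod_surjective {R : Type*} [CommRing R] (π : R) : Function.Surjective (redMod π) :=
  Polynomial.map_surjective _ Ideal.Quotient.mk_surjective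

theorem redMod_eq_zero_iff {R : Type*} [CommRing R] (π : R) (g : R[X]) :
    redMod π g = 0 ↔ C π ∣ g := by
  rw [redMod, ← RingHom.mem_ker, Polynomial.ker_mapRingHom, Ideal.mk_ker, Ideal.map_span,
    Set.image_singleton, Ideal.mem_span_singleton]

theorem IsCanonicalSequence.redMod_dvd {R : Type*} [CommRing R] {π : R}
    (hπ : (Ideal.span {π}).IsMaximal) {n : ℕ} {I : Ideal R[X]} {f : ℕ → R[X]}
    (hf : IsCanonicalSequence π n I f) {i : ℕ} (hi : i < n) {g : R[X]}
    (hg : C π ^ i * g ∈ I) : redMod π (f i) ∣ redMod π g := by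
  let := Ideal.Quotient.field (Ideal.span {π})
  by_cases h0 : redMod π (f i) = 0
  · rcases (hf i hi).2 g hg with h | h
    · exact h ▸ dvd_zero _
    · exact absurd h0 h.1
  obtain ⟨q, hq⟩ := redMod_surjective π (redMod π g / redMod π (f i))
  have hmod : redMod π (g - f i * q) = redMod π g % redMod π (f i) := by
    rw [map_sub, map_mul, hq, EuclideanDomain.mod_eq_sub_mul_div]
  have hmem : C π ^ i * (g - f i * q) ∈ I := by
    have := I.sub_mem hg (I.mul_mem_right q (hf i hi).1)
    rwa [mul_assoc, ← mul_sub] at this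
  rcases (hf i hi).2 _ hmem with h | h
  · exact EuclideanDomain.mod_eq_zero.1 (hmod ▸ h)
  · exact absurd (hmod ▸ h.2) (Polynomial.degree_mod_lt _ h0).not_ge

theorem IsCanonicalSequence.isPrimaryLayer {R : Type*} [CommRing R] {π : R}
    (hπ : (Ideal.span {π}).IsMaximal) (hnil : π ^ 2 = 0) {r b : R[X]}
    (hr : Irreducible (redMod π r)) {e0 e1 : ℕ} (he0 : 0 < e0) {I : Ideal R[X]}
    (hcan : IsCanonicalSequence π 2 I (fun j =>
      if j = 0 then r ^ e0 + C π * b else r ^ e1)) :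
    IsPrimaryLayer (redMod π) (C π) r b e0 e1 I := by
  have hpp : C π * C π = 0 := by rw [← C_mul, ← sq, hnil, C_0]
  have hred : redMod π (C π) = 0 := (redMod_eq_zero_iff π _).2 dvd_rfl
  refine ⟨redMod_surjective π, redMod_eq_zero_iff π, hpp, hr, he0,
    by simpa using (hcan 0 two_pos).1, fun g hg => ?_, fun g => ⟨fun hg => ?_, ?_⟩⟩
  · simpa [hred] using hcan.redMod_dvd hπ two_pos (g := g) (by simpa using hg)
  · simpa using hcan.redMod_dvd hπ one_lt_two (g := g) (by simpa using hg)
  · rintro ⟨c, hc⟩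
    obtain ⟨c, rfl⟩ := redMod_surjective π c
    obtain ⟨z, hz⟩ := (redMod_eq_zero_iff π (g - r ^ e1 * c)).1 (by simp [hc])
    have hmem : C π * r ^ e1 ∈ I := by simpa using (hcan 1 one_lt_two).1
    have heq : C π * g = C π * r ^ e1 * c := by linear_combination C π * hz + z * hpp
    rw [heq]
    exact I.mul_mem_right c hmem

theorem isNoetherianRing_of_maximalIdeal_eq_span {R : Type*} [CommRing R] [IsLocalRing R]
    {π : R} (hmax : IsLocalRing.maximalIdeal R = Ideal.span {π}) (hπ : IsNilpotent π) :
    IsNoetherianRing R := by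
  refine IsNoetherianRing.of_prime fun J hJ => ?_
  have hle : IsLocalRing.maximalIdeal R ≤ J := by
    rw [hmax, Ideal.span_singleton_le_iff_mem]
    obtain ⟨k, hk⟩ := hπ
    exact hJ.mem_of_pow_mem k (hk ▸ J.zero_mem)
  rw [← (IsLocalRing.maximalIdeal.isMaximal R).eq_of_le hJ.ne_top hle, hmax]
  exact ⟨{π}, by simp⟩

/-- Theorem 7.3 (nilpotency 2): for an ideal `I` with canonical sequence
`(r^{e₀} + π b₀₁, r^{e₁})`, `r̄` irreducible: (i) if `e₁ = 0` or `e₁ = e₀`, then `R[x]/I`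
is Frobenius and local; (ii) if `e₀ > e₁ > 0`, then `R[x]/I` is Frobenius and local iff
`r̄ ∤ b̄₀₁`. -/
theorem chain_nilpotency_two_frobenius_local {R : Type*} [CommRing R] [IsLocalRing R]
    (π : R) (hmax : IsLocalRing.maximalIdeal R = Ideal.span {π})
    (hnil : π ^ 2 = 0) (hπ : π ≠ 0)
    (r b01 : R[X]) (hr : Irreducible (redMod π r))
    (e0 e1 : ℕ) (he : e1 ≤ e0) (he0 : 0 < e0)
    (I : Ideal R[X])
    (hcan : IsCanonicalSequence π 2 I (fun j =>
      if j = 0 then r ^ e0 + C π * b01 else r ^ e1)) :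
    ((e1 = 0 ∨ e1 = e0) → (IsFrobeniusRing (R[X] ⧸ I) ∧ IsLocalRing (R[X] ⧸ I))) ∧
    (e1 < e0 → 0 < e1 →
      ((IsFrobeniusRing (R[X] ⧸ I) ∧ IsLocalRing (R[X] ⧸ I)) ↔
        ¬ redMod π r ∣ redMod π b01)) := by
  have hmaxl : (Ideal.span {π}).IsMaximal := hmax ▸ IsLocalRing.maximalIdeal.isMaximal R
  have := isNoetherianRing_of_maximalIdeal_eq_span hmax ⟨2, hnil⟩
  have h := hcan.isPrimaryLayer hmaxl hnil hr he0
  let := Ideal.Quotient.field (Ideal.span {π})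
  refine ⟨fun h1 => ⟨?_, h.isLocalRing⟩, fun hlt hpos =>
    ⟨fun hF => h.not_dvd_of_isFrobeniusRing hpos hlt hF.1,
      fun hb => ⟨h.isFrobeniusRing_of_pos hpos (.inr hb), h.isLocalRing⟩⟩⟩
  rcases h1 with h1 | h1
  · exact h.isFrobeniusRing_of_eq_zero h1
  · exact h.isFrobeniusRing_of_pos (h1 ▸ he0) (.inl h1)
end

section
/- Let p be a prime and let a, b, m, n be integers with n ≥ 2, 0 < a < b ≤ m, and 2b − a ≥ m. Then the quotient ring ℤ/p^m[x] / ⟨x^n, p^a x^{n−1} − p^b⟩ is Frobenius and local if and only if 2b − a = m. (In all cases this quotient is an artinian local ring; it has a unique minimal ideal precisely when 2b − a = m.) -/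
open Polynomial

theorem IsLocalRing.isFrobeniusRing_iff_existsUnique_isAtom {S : Type*} [CommRing S]
    [IsArtinianRing S] [IsLocalRing S] :
    IsFrobeniusRing S ↔ ∃! A : Ideal S, IsAtom A := by
  rw [IsFrobeniusRing, IsLocalRing.jacobson_eq_maximalIdeal ⊥ bot_ne_top]
  constructor
  · rintro ⟨-, ⟨e⟩⟩
    have hsimple : IsSimpleModule S (S ⧸ maximalIdeal S) :=
      isSimpleModule_iff_isCoatom.mpr (maximalIdeal.isMaximal S).out
    have hatom : IsAtom (sSup {J : Ideal S | IsAtom J}) :=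
      isSimpleModule_iff_isAtom.mp (IsSimpleModule.congr e.symm)
    refine ⟨_, hatom, fun A hA => ?_⟩
    exact (hatom.le_iff_eq hA.1).mp (le_sSup hA)
  · rintro ⟨A, hA, huniq⟩
    refine ⟨inferInstance, ?_⟩
    have hset : {J : Ideal S | IsAtom J} = {A} :=
      Set.eq_singleton_iff_unique_mem.mpr ⟨hA, huniq⟩
    rw [hset, sSup_singleton]
    have hsimple : IsSimpleModule S A := isSimpleModule_iff_isAtom.mpr hA
    obtain ⟨M, hM, ⟨e⟩⟩ := isSimpleModule_iff_quot_maximal.mp hsimple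
    rw [IsLocalRing.eq_maximalIdeal hM] at e
    exact ⟨e.symm⟩

theorem Ideal.isAtom_span_singleton_of_not_isUnit_mul_eq_zero {S : Type*} [CommRing S] {s : S}
    (hs : s ≠ 0) (h : ∀ r : S, ¬ IsUnit r → r * s = 0) : IsAtom (Ideal.span {s}) := by
  refine ⟨by simpa using hs, fun J hJ => ?_⟩
  by_contra hne
  obtain ⟨y, hyJ, hy⟩ := Submodule.exists_mem_ne_zero_of_ne_bot hne
  obtain ⟨r, rfl⟩ := Ideal.mem_span_singleton'.mp (hJ.le hyJ)
  have hr : IsUnit r := by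
    by_contra hr
    exact hy (h r hr)
  refine hJ.not_ge ((Ideal.span_singleton_le_iff_mem _).mpr ?_)
  exact (Ideal.unit_mul_mem_iff_mem J hr).mp hyJ

theorem IsAtom.mul_eq_zero_of_not_isUnit {S : Type*} [CommRing S] [IsLocalRing S] {A : Ideal S}
    (hA : IsAtom A) {y q : S} (hy : y ∈ A) (hq : ¬ IsUnit q) : q * y = 0 := by
  by_contra hne
  have hspan : Ideal.span {q * y} = A :=
    (hA.le_iff_eq (by simpa using hne)).mp
      ((Ideal.span_singleton_le_iff_mem _).mpr (A.mul_mem_left q hy))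
  obtain ⟨r, hr⟩ := Ideal.mem_span_singleton'.mp (hspan.symm ▸ hy)
  have hu : IsUnit (1 - r * q) := by
    rcases IsLocalRing.isUnit_or_isUnit_one_sub_self (r * q) with h | h
    · exact absurd (isUnit_of_mul_isUnit_right h) hq
    · exact h
  have hy0 : y = 0 := hu.mul_right_eq_zero.mp (by linear_combination -hr)
  exact hne (by rw [hy0, mul_zero])

namespace ZMod

variable {p m : ℕ}

theorem natCast_pow_eq_zero_iff_le (hp : p.Prime) (k : ℕ) :
    (p : ZMod (p ^ m)) ^ k = 0 ↔ m ≤ k := by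
  rw [← Nat.cast_pow, ZMod.natCast_eq_zero_iff, Nat.pow_dvd_pow_iff_le_right hp.one_lt]

theorem exists_eq_natCast_pow_mul (hp : p.Prime) {i j : ℕ} (hij : i + j = m) {y : ZMod (p ^ m)}
    (hy : (p : ZMod (p ^ m)) ^ i * y = 0) : ∃ w, y = (p : ZMod (p ^ m)) ^ j * w := by
  obtain ⟨z, rfl⟩ := ZMod.intCast_surjective y
  have h : ((p ^ i * z : ℤ) : ZMod (p ^ m)) = 0 := by push_cast; exact hy
  rw [ZMod.intCast_zmod_eq_zero_iff_dvd, ← hij] at h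
  push_cast at h
  rw [pow_add] at h
  obtain ⟨w, rfl⟩ := (mul_dvd_mul_iff_left (pow_ne_zero i (by exact_mod_cast hp.ne_zero))).mp h
  exact ⟨w, by push_cast; rfl⟩

theorem isUnit_or_exists_eq_natCast_mul (hp : p.Prime) (c : ZMod (p ^ m)) :
    IsUnit c ∨ ∃ w, c = (p : ZMod (p ^ m)) * w := by
  obtain ⟨z, rfl⟩ := ZMod.intCast_surjective c
  by_cases h : (p : ℤ) ∣ z
  · obtain ⟨w, rfl⟩ := h
    exact Or.inr ⟨w, by push_cast; rfl⟩
  · left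
    have hco : IsCoprime z ((p ^ m : ℕ) : ℤ) := by
      push_cast
      exact ((Nat.prime_iff_prime_int.mp hp).coprime_iff_not_dvd.mpr h).symm.pow_right
    obtain ⟨u, v, huv⟩ := hco
    refine IsUnit.of_mul_eq_one (u : ZMod (p ^ m)) ?_
    have := congrArg (Int.cast : ℤ → ZMod (p ^ m)) huv
    push_cast at this
    have h0 : (p : ZMod (p ^ m)) ^ m = 0 := by exact_mod_cast ZMod.natCast_self (p ^ m)
    rw [h0] at this
    linear_combination this

end ZMod

/-- The ideal `⟨x ^ n, p ^ a x ^ (n - 1) - p ^ b⟩` of `(ℤ / p ^ m)[x]`. -/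
noncomputable abbrev truncationIdeal (p a b m n : ℕ) : Ideal (ZMod (p ^ m))[X] :=
  Ideal.span {(X : (ZMod (p ^ m))[X]) ^ n,
    C ((p : ZMod (p ^ m)) ^ a) * X ^ (n - 1) - C ((p : ZMod (p ^ m)) ^ b)}

namespace truncationIdeal

variable {p a b m n : ℕ}

theorem exists_coeff_eq (hn : 2 ≤ n) {f : (ZMod (p ^ m))[X]}
    (hf : f ∈ truncationIdeal p a b m n) :
    ∃ v : ℕ → ZMod (p ^ m), (∀ i < n - 1, f.coeff i = -((p : ZMod (p ^ m)) ^ b * v i)) ∧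
      f.coeff (n - 1) = (p : ZMod (p ^ m)) ^ a * v 0 - (p : ZMod (p ^ m)) ^ b * v (n - 1) := by
  obtain ⟨u, v, rfl⟩ := Ideal.mem_span_pair.mp hf
  have hcoeff : ∀ i < n, (u * X ^ n + v * (C ((p : ZMod (p ^ m)) ^ a) * X ^ (n - 1)
      - C ((p : ZMod (p ^ m)) ^ b))).coeff i =
      (if n - 1 ≤ i then (p : ZMod (p ^ m)) ^ a * v.coeff (i - (n - 1)) else 0)
        - (p : ZMod (p ^ m)) ^ b * v.coeff i := by
    intro i hi
    have hsplit : v * (C ((p : ZMod (p ^ m)) ^ a) * X ^ (n - 1) - C ((p : ZMod (p ^ m)) ^ b)) =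
        C ((p : ZMod (p ^ m)) ^ a) * (v * X ^ (n - 1)) - C ((p : ZMod (p ^ m)) ^ b) * v := by ring
    rw [hsplit, coeff_add, coeff_sub, coeff_C_mul, coeff_C_mul, coeff_mul_X_pow',
      coeff_mul_X_pow', if_neg (by omega)]
    split_ifs <;> simp
  refine ⟨v.coeff, fun i hi => ?_, ?_⟩
  · rw [hcoeff i (by omega), if_neg (by omega)]
    ring
  · rw [hcoeff _ (by omega), if_pos le_rfl, Nat.sub_self]

theorem X_pow_mem : (X : (ZMod (p ^ m))[X]) ^ n ∈ truncationIdeal p a b m n :=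
  Ideal.subset_span (by simp)

theorem C_mul_X_pow_sub_C_mem :
    C ((p : ZMod (p ^ m)) ^ a) * X ^ (n - 1) - C ((p : ZMod (p ^ m)) ^ b)
      ∈ truncationIdeal p a b m n :=
  Ideal.subset_span (by simp)

theorem C_mul_X_mem (hn : 2 ≤ n) :
    C ((p : ZMod (p ^ m)) ^ b) * X ∈ truncationIdeal p a b m n := by
  obtain ⟨k, rfl⟩ : ∃ k, n = k + 1 := ⟨n - 1, by omega⟩
  have h := Ideal.sub_mem _
    (Ideal.mul_mem_left _ (C ((p : ZMod (p ^ m)) ^ a)) (X_pow_mem (p := p) (a := a) (b := b)))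
    (Ideal.mul_mem_left _ X (C_mul_X_pow_sub_C_mem (p := p) (a := a) (b := b) (m := m)
      (n := k + 1)))
  convert h using 1
  rw [Nat.add_sub_cancel]
  ring

theorem C_mul_X_pow_mem (hbm : b ≤ m) :
    C ((p : ZMod (p ^ m)) ^ (m - b + a)) * X ^ (n - 1) ∈ truncationIdeal p a b m n := by
  have h := Ideal.mul_mem_left _ (C ((p : ZMod (p ^ m)) ^ (m - b)))
    (C_mul_X_pow_sub_C_mem (p := p) (a := a) (b := b) (m := m) (n := n))
  have h0 : (p : ZMod (p ^ m)) ^ m = 0 := by exact_mod_cast ZMod.natCast_self (p ^ m)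
  have h1 : C ((p : ZMod (p ^ m)) ^ (m - b)) * C ((p : ZMod (p ^ m)) ^ b) = 0 := by
    rw [← C_mul, ← pow_add, Nat.sub_add_cancel hbm, h0, C_0]
  rw [mul_sub, h1, sub_zero, ← mul_assoc, ← C_mul, ← pow_add] at h
  exact h

theorem one_notMem (hp : p.Prime) (hn : 2 ≤ n) (hb : 0 < b) (hbm : b ≤ m) :
    (1 : (ZMod (p ^ m))[X]) ∉ truncationIdeal p a b m n := by
  intro h
  obtain ⟨v, hv, -⟩ := exists_coeff_eq hn h
  have h0 := hv 0 (by omega)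
  rw [coeff_one_zero] at h0
  have hm : (p : ZMod (p ^ m)) ^ (m - 1) = 0 := by
    have hz : (p : ZMod (p ^ m)) ^ (m - 1 + b) = 0 :=
      (ZMod.natCast_pow_eq_zero_iff_le hp _).mpr (by omega)
    rw [pow_add] at hz
    linear_combination (p : ZMod (p ^ m)) ^ (m - 1) * h0 - v 0 * hz
  have := (ZMod.natCast_pow_eq_zero_iff_le hp _).mp hm
  omega

theorem C_mul_X_pow_notMem (hp : p.Prime) (hn : 2 ≤ n) (ha : 0 < a) (hab : a < b) (hbm : b ≤ m)
    (hba : m ≤ 2 * b - a) :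
    C ((p : ZMod (p ^ m)) ^ (m - b + a - 1)) * X ^ (n - 1) ∉ truncationIdeal p a b m n := by
  intro h
  obtain ⟨v, hv, hv'⟩ := exists_coeff_eq hn h
  have h0 := hv 0 (by omega)
  rw [coeff_C_mul_X_pow, if_neg (by omega)] at h0
  rw [coeff_C_mul_X_pow, if_pos rfl] at hv'
  have hz : (p : ZMod (p ^ m)) ^ (b - a + b) = 0 :=
    (ZMod.natCast_pow_eq_zero_iff_le hp _).mpr (by omega)
  have e1 : (p : ZMod (p ^ m)) ^ (m - 1) =
      (p : ZMod (p ^ m)) ^ (b - a) * (p : ZMod (p ^ m)) ^ (m - b + a - 1) := by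
    rw [← pow_add]; congr 1; omega
  have e2 : (p : ZMod (p ^ m)) ^ b = (p : ZMod (p ^ m)) ^ (b - a) * (p : ZMod (p ^ m)) ^ a := by
    rw [← pow_add]; congr 1; omega
  have hm : (p : ZMod (p ^ m)) ^ (m - 1) = 0 := by
    rw [pow_add] at hz
    linear_combination e1 + (p : ZMod (p ^ m)) ^ (b - a) * hv' - v 0 * e2 + h0 - v (n - 1) * hz
  have := (ZMod.natCast_pow_eq_zero_iff_le hp _).mp hm
  omega

theorem isUnit_mk_or_exists (hp : p.Prime) (f : (ZMod (p ^ m))[X]) :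
    IsUnit (Ideal.Quotient.mk (truncationIdeal p a b m n) f) ∨
      ∃ c g, f = C (p : ZMod (p ^ m)) * c + X * g := by
  rcases ZMod.isUnit_or_exists_eq_natCast_mul hp (f.coeff 0) with h | ⟨w, hw⟩
  · left
    have hX : IsNilpotent (Ideal.Quotient.mk (truncationIdeal p a b m n) (X * f.divX)) := by
      rw [map_mul]
      refine (Commute.all _ _).isNilpotent_mul_right ⟨n, ?_⟩
      rw [← map_pow]
      exact Ideal.Quotient.eq_zero_iff_mem.mpr X_pow_mem
    rw [← f.X_mul_divX_add, map_add]
    exact hX.isUnit_add_right_of_commute ((h.map C).map (Ideal.Quotient.mk _)) (Commute.all _ _)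
  · right
    refine ⟨C w, f.divX, ?_⟩
    rw [← C_mul, ← hw, add_comm, f.X_mul_divX_add]

theorem not_isUnit_mk (hp : p.Prime) (hn : 2 ≤ n) (hb : 0 < b) (hbm : b ≤ m)
    {f c g : (ZMod (p ^ m))[X]} (hf : f = C (p : ZMod (p ^ m)) * c + X * g) :
    ¬ IsUnit (Ideal.Quotient.mk (truncationIdeal p a b m n) f) := by
  have : Nontrivial ((ZMod (p ^ m))[X] ⧸ truncationIdeal p a b m n) :=
    Ideal.Quotient.nontrivial_iff.mpr
      fun h => one_notMem hp hn hb hbm ((Ideal.eq_top_iff_one _).mp h)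
  have hnil : IsNilpotent (Ideal.Quotient.mk (truncationIdeal p a b m n) f) := by
    rw [hf, map_add, map_mul, map_mul]
    refine (Commute.all _ _).isNilpotent_add ((Commute.all _ _).isNilpotent_mul_right ⟨m, ?_⟩)
      ((Commute.all _ _).isNilpotent_mul_right ⟨n, ?_⟩)
    · rw [← map_pow, ← map_pow, (ZMod.natCast_pow_eq_zero_iff_le hp m).mpr le_rfl, map_zero,
        map_zero]
    · rw [← map_pow]
      exact Ideal.Quotient.eq_zero_iff_mem.mpr X_pow_mem
  exact hnil.not_isUnit

theorem isLocalRing_quotient (hp : p.Prime) (hn : 2 ≤ n) (hb : 0 < b) (hbm : b ≤ m) :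
    IsLocalRing ((ZMod (p ^ m))[X] ⧸ truncationIdeal p a b m n) := by
  have : Nontrivial ((ZMod (p ^ m))[X] ⧸ truncationIdeal p a b m n) :=
    Ideal.Quotient.nontrivial_iff.mpr
      fun h => one_notMem hp hn hb hbm ((Ideal.eq_top_iff_one _).mp h)
  refine IsLocalRing.of_nonunits_add fun x y hx hy => ?_
  obtain ⟨f, rfl⟩ := Ideal.Quotient.mk_surjective x
  obtain ⟨g, rfl⟩ := Ideal.Quotient.mk_surjective y
  obtain ⟨c, d, hf⟩ := (isUnit_mk_or_exists hp f).resolve_left hx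
  obtain ⟨c', d', hg⟩ := (isUnit_mk_or_exists hp g).resolve_left hy
  rw [← map_add]
  exact not_isUnit_mk hp hn hb hbm (c := c + c') (g := d + d') (by rw [hf, hg]; ring)

theorem isArtinianRing_quotient (hp : p.Prime) :
    IsArtinianRing ((ZMod (p ^ m))[X] ⧸ truncationIdeal p a b m n) := by
  have : NeZero (p ^ m) := ⟨pow_ne_zero m hp.ne_zero⟩
  have hfin : Module.Finite (ZMod (p ^ m))
      ((ZMod (p ^ m))[X] ⧸ Ideal.span {(X : (ZMod (p ^ m))[X]) ^ n}) :=
    (monic_X_pow n).finite_quotient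
  have hle : Ideal.span {(X : (ZMod (p ^ m))[X]) ^ n} ≤ truncationIdeal p a b m n :=
    (Ideal.span_singleton_le_iff_mem _).mpr X_pow_mem
  have : IsArtinianRing ((ZMod (p ^ m))[X] ⧸ Ideal.span {(X : (ZMod (p ^ m))[X]) ^ n}) :=
    IsArtinianRing.of_finite (ZMod (p ^ m)) _
  exact (Ideal.Quotient.factor_surjective hle).isArtinianRing

theorem isAtom_span_mk (hp : p.Prime) {s : (ZMod (p ^ m))[X]}
    (hs : s ∉ truncationIdeal p a b m n)
    (hps : C (p : ZMod (p ^ m)) * s ∈ truncationIdeal p a b m n)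
    (hXs : X * s ∈ truncationIdeal p a b m n) :
    IsAtom (Ideal.span {Ideal.Quotient.mk (truncationIdeal p a b m n) s}) := by
  refine Ideal.isAtom_span_singleton_of_not_isUnit_mul_eq_zero
    (fun h => hs (Ideal.Quotient.eq_zero_iff_mem.mp h)) fun r hr => ?_
  obtain ⟨f, rfl⟩ := Ideal.Quotient.mk_surjective r
  obtain ⟨c, g, rfl⟩ := (isUnit_mk_or_exists hp f).resolve_left hr
  rw [← map_mul, Ideal.Quotient.eq_zero_iff_mem]
  have h := Ideal.add_mem _ (Ideal.mul_mem_left _ c hps) (Ideal.mul_mem_left _ g hXs)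
  convert h using 1
  ring

theorem isAtom_span_mk_C_mul_X_pow (hp : p.Prime) (hn : 2 ≤ n) (ha : 0 < a) (hab : a < b)
    (hbm : b ≤ m) (hba : m ≤ 2 * b - a) :
    IsAtom (Ideal.span {Ideal.Quotient.mk (truncationIdeal p a b m n)
      (C ((p : ZMod (p ^ m)) ^ (m - b + a - 1)) * X ^ (n - 1))}) := by
  refine isAtom_span_mk hp (C_mul_X_pow_notMem hp hn ha hab hbm hba) ?_ ?_
  · rw [← mul_assoc, ← C_mul, ← pow_succ', Nat.sub_add_cancel (by omega)]
    exact C_mul_X_pow_mem hbm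
  · rw [mul_left_comm, ← pow_succ', Nat.sub_add_cancel (by omega)]
    exact Ideal.mul_mem_left _ _ X_pow_mem

theorem exists_socle_generator (hn : 2 ≤ n) (ha : 0 < a) (hab : a < b)
    (hbm : b ≤ m) (hba : m < 2 * b - a) :
    ∃ t : (ZMod (p ^ m))[X], t.coeff (n - 2) = (p : ZMod (p ^ m)) ^ (b - 1) ∧
      C (p : ZMod (p ^ m)) * t ∈ truncationIdeal p a b m n ∧
      X * t ∈ truncationIdeal p a b m n := by
  have hX : C ((p : ZMod (p ^ m)) ^ (b - 1)) * X ^ (n - 1) ∈ truncationIdeal p a b m n := by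
    have h := Ideal.mul_mem_left _ (C ((p : ZMod (p ^ m)) ^ (b - 1 - (m - b + a))))
      (C_mul_X_pow_mem (p := p) (a := a) (n := n) hbm)
    rw [← mul_assoc, ← C_mul, ← pow_add, Nat.sub_add_cancel (by omega)] at h
    exact h
  obtain rfl | hn3 := hn.eq_or_lt
  · refine ⟨C ((p : ZMod (p ^ m)) ^ (b - 1)) - C ((p : ZMod (p ^ m)) ^ (a - 1)) * X ^ 1,
      ?_, ?_, ?_⟩
    · rw [coeff_sub, coeff_C, coeff_C_mul_X_pow, if_pos rfl, if_neg (by omega), sub_zero]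
    · have h := Ideal.neg_mem_iff _ |>.mpr
        (C_mul_X_pow_sub_C_mem (p := p) (a := a) (b := b) (m := m) (n := 2))
      rw [mul_sub, ← mul_assoc, ← C_mul, ← C_mul, ← pow_succ', ← pow_succ',
        Nat.sub_add_cancel (by omega), Nat.sub_add_cancel ha]
      simpa using h
    · have h := Ideal.sub_mem _ hX (Ideal.mul_mem_left _ (C ((p : ZMod (p ^ m)) ^ (a - 1)))
        (X_pow_mem (p := p) (a := a) (b := b) (n := 2)))
      convert h using 1
      ring
  · refine ⟨C ((p : ZMod (p ^ m)) ^ (b - 1)) * X ^ (n - 2), ?_, ?_, ?_⟩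
    · rw [coeff_C_mul_X_pow, if_pos rfl]
    · rw [← mul_assoc, ← C_mul, ← pow_succ', Nat.sub_add_cancel (by omega)]
      obtain ⟨k, rfl⟩ : ∃ k, n = k + 3 := ⟨n - 3, by omega⟩
      have h := Ideal.mul_mem_left _ (X ^ k)
        (C_mul_X_mem (p := p) (a := a) (b := b) (m := m) hn)
      convert h using 1
      rw [show k + 3 - 2 = k + 1 by omega]
      ring
    · rw [mul_left_comm, ← pow_succ', show n - 2 + 1 = n - 1 by omega]
      exact hX

theorem notMem_of_coeff_eq (hp : p.Prime) (hn : 2 ≤ n) (hb : 0 < b) (hbm : b ≤ m)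
    {t : (ZMod (p ^ m))[X]} (ht : t.coeff (n - 2) = (p : ZMod (p ^ m)) ^ (b - 1)) :
    t ∉ truncationIdeal p a b m n := by
  intro h
  obtain ⟨v, hv, -⟩ := exists_coeff_eq hn h
  have h0 := hv (n - 2) (by omega)
  rw [ht] at h0
  have e1 : (p : ZMod (p ^ m)) ^ (m - 1) =
      (p : ZMod (p ^ m)) ^ (m - b) * (p : ZMod (p ^ m)) ^ (b - 1) := by
    rw [← pow_add]; congr 1; omega
  have hz : (p : ZMod (p ^ m)) ^ (m - b + b) = 0 :=
    (ZMod.natCast_pow_eq_zero_iff_le hp _).mpr (by omega)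
  have hm : (p : ZMod (p ^ m)) ^ (m - 1) = 0 := by
    rw [pow_add] at hz
    linear_combination e1 + (p : ZMod (p ^ m)) ^ (m - b) * h0 - v (n - 2) * hz
  have := (ZMod.natCast_pow_eq_zero_iff_le hp _).mp hm
  omega

theorem eq_of_existsUnique_isAtom (hp : p.Prime) (hn : 2 ≤ n) (ha : 0 < a) (hab : a < b)
    (hbm : b ≤ m) (hba : m ≤ 2 * b - a)
    (h : ∃! A : Ideal ((ZMod (p ^ m))[X] ⧸ truncationIdeal p a b m n), IsAtom A) :
    2 * b - a = m := by
  by_contra hne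
  obtain ⟨t, ht, hpt, hXt⟩ := exists_socle_generator (p := p) hn ha hab hbm (by omega)
  have hspan := h.unique
    (isAtom_span_mk hp (notMem_of_coeff_eq hp hn (by omega) hbm ht) hpt hXt)
    (isAtom_span_mk_C_mul_X_pow hp hn ha hab hbm hba)
  obtain ⟨r, hr⟩ := Ideal.mem_span_singleton'.mp
    (hspan ▸ Ideal.mem_span_singleton_self (Ideal.Quotient.mk (truncationIdeal p a b m n) t))
  obtain ⟨f, rfl⟩ := Ideal.Quotient.mk_surjective r
  rw [← map_mul, eq_comm, Ideal.Quotient.eq] at hr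
  refine notMem_of_coeff_eq hp hn (by omega) hbm ?_ hr
  rw [coeff_sub, ht, ← mul_assoc, coeff_mul_X_pow', if_neg (by omega), sub_zero]

theorem natCast_pow_dvd_of_mul_eq_zero (hp : p.Prime) (hab : a < b) (hbm : b ≤ m)
    (hm : 2 * b - a = m) {v : ZMod (p ^ m)} (hv : (p : ZMod (p ^ m)) ^ b * v = 0) :
    (p : ZMod (p ^ m)) ^ b ∣ (p : ZMod (p ^ m)) ^ a * v := by
  obtain ⟨w, rfl⟩ := ZMod.exists_eq_natCast_pow_mul hp (Nat.add_sub_of_le hbm) hv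
  refine ⟨w, ?_⟩
  rw [← mul_assoc, ← pow_add]
  congr 2
  omega

theorem exists_sub_C_mul_X_pow_mem (hp : p.Prime) (hn : 2 ≤ n) (hab : a < b) (hbm : b ≤ m)
    (hm : 2 * b - a = m) {f : (ZMod (p ^ m))[X]} (hf : X * f ∈ truncationIdeal p a b m n) :
    ∃ e, f - C e * X ^ (n - 1) ∈ truncationIdeal p a b m n := by
  obtain ⟨v, hv, hv'⟩ := exists_coeff_eq hn hf
  have hdvd : ∀ i < n - 1, (p : ZMod (p ^ m)) ^ b ∣ f.coeff i := by
    intro i hi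
    obtain hlt | heq : i + 1 < n - 1 ∨ i + 1 = n - 1 := by omega
    · have h := hv (i + 1) hlt
      rw [coeff_X_mul] at h
      exact ⟨-v (i + 1), by rw [h, mul_neg]⟩
    · rw [← heq, coeff_X_mul] at hv'
      have h0 := hv 0 (by omega)
      rw [coeff_X_mul_zero, zero_eq_neg] at h0
      rw [hv']
      exact dvd_sub (natCast_pow_dvd_of_mul_eq_zero hp hab hbm hm h0) (dvd_mul_right _ _)
  obtain ⟨w, hw⟩ := hdvd 0 (by omega)
  have hrest : f - C (f.coeff 0) - C (f.coeff (n - 1)) * X ^ (n - 1)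
      ∈ truncationIdeal p a b m n := by
    set g := f - C (f.coeff 0) - C (f.coeff (n - 1)) * X ^ (n - 1) with hg
    have hcoeff : ∀ i, g.coeff i = f.coeff i - (if i = 0 then f.coeff 0 else 0)
        - (if i = n - 1 then f.coeff (n - 1) else 0) := by
      intro i
      rw [hg, coeff_sub, coeff_sub, coeff_C, coeff_C_mul_X_pow]
    rw [g.as_sum_support_C_mul_X_pow]
    refine Ideal.sum_mem _ fun i _ => ?_
    by_cases hi : n ≤ i
    · rw [← Nat.sub_add_cancel hi, pow_add, ← mul_assoc]
      exact Ideal.mul_mem_left _ _ X_pow_mem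
    by_cases hi0 : i = 0
    · rw [hcoeff, if_pos hi0, if_neg (by omega), hi0]
      simp
    by_cases hi1 : i = n - 1
    · rw [hcoeff, if_neg hi0, if_pos hi1, hi1]
      simp
    obtain ⟨u, hu⟩ := hdvd i (by omega)
    obtain ⟨j, rfl⟩ := Nat.exists_eq_succ_of_ne_zero hi0
    have h := Ideal.mul_mem_left _ (C u * X ^ j)
      (C_mul_X_mem (p := p) (a := a) (b := b) (m := m) hn)
    rw [hcoeff, if_neg hi0, if_neg hi1, hu]
    convert h using 1
    simp only [sub_zero, C_mul, Nat.succ_eq_add_one]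
    ring
  refine ⟨f.coeff (n - 1) + (p : ZMod (p ^ m)) ^ a * w, ?_⟩
  have h := Ideal.sub_mem _ hrest (Ideal.mul_mem_left _ (C w)
    (C_mul_X_pow_sub_C_mem (p := p) (a := a) (b := b) (m := m) (n := n)))
  convert h using 1
  rw [hw, C_add, C_mul, C_mul]
  ring

theorem natCast_pow_dvd_of_C_mul_mem (hp : p.Prime) (hn : 2 ≤ n) (hab : a < b) (hbm : b ≤ m)
    (hm : 2 * b - a = m) {e : ZMod (p ^ m)}
    (he : C (p : ZMod (p ^ m)) * (C e * X ^ (n - 1)) ∈ truncationIdeal p a b m n) :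
    (p : ZMod (p ^ m)) ^ (b - 1) ∣ e := by
  obtain ⟨v, hv, hv'⟩ := exists_coeff_eq hn he
  have h0 := hv 0 (by omega)
  rw [coeff_C_mul, coeff_C_mul_X_pow, if_neg (by omega), mul_zero, zero_eq_neg] at h0
  rw [coeff_C_mul, coeff_C_mul_X_pow, if_pos rfl] at hv'
  obtain ⟨k, hk⟩ : (p : ZMod (p ^ m)) ^ b ∣ p * e := by
    rw [hv']
    exact dvd_sub (natCast_pow_dvd_of_mul_eq_zero hp hab hbm hm h0) (dvd_mul_right _ _)
  have hb : (p : ZMod (p ^ m)) ^ b = p * (p : ZMod (p ^ m)) ^ (b - 1) := by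
    rw [← pow_succ', Nat.sub_add_cancel (by omega)]
  obtain ⟨w, hw⟩ := ZMod.exists_eq_natCast_pow_mul hp (i := 1) (j := m - 1)
    (y := e - (p : ZMod (p ^ m)) ^ (b - 1) * k) (by omega)
    (by linear_combination hk + k * hb)
  rw [sub_eq_iff_eq_add] at hw
  rw [hw]
  exact dvd_add ((pow_dvd_pow _ (by omega)).mul_right _) (dvd_mul_right _ _)

theorem existsUnique_isAtom (hp : p.Prime) (hn : 2 ≤ n) (ha : 0 < a) (hab : a < b)
    (hbm : b ≤ m) (hm : 2 * b - a = m) :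
    ∃! A : Ideal ((ZMod (p ^ m))[X] ⧸ truncationIdeal p a b m n), IsAtom A := by
  have := isLocalRing_quotient (a := a) hp hn (by omega : 0 < b) hbm
  have hatom := isAtom_span_mk_C_mul_X_pow hp hn ha hab hbm hm.ge
  refine ⟨_, hatom, fun A hA => ?_⟩
  obtain ⟨y, hyA, hy⟩ := Submodule.exists_mem_ne_zero_of_ne_bot hA.1
  obtain ⟨f, rfl⟩ := Ideal.Quotient.mk_surjective y
  have hXf := hA.mul_eq_zero_of_not_isUnit hyA
    (not_isUnit_mk (f := X) (c := 0) (g := 1) hp hn (by omega) hbm (by ring))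
  have hpf := hA.mul_eq_zero_of_not_isUnit hyA
    (not_isUnit_mk (f := C (p : ZMod (p ^ m))) (c := 1) (g := 0) hp hn (by omega) hbm (by ring))
  rw [← map_mul, Ideal.Quotient.eq_zero_iff_mem] at hXf hpf
  obtain ⟨e, he⟩ := exists_sub_C_mul_X_pow_mem hp hn hab hbm hm hXf
  obtain ⟨k, rfl⟩ := natCast_pow_dvd_of_C_mul_mem hp hn hab hbm hm (e := e) (by
    have h := Ideal.sub_mem _ hpf (Ideal.mul_mem_left _ (C (p : ZMod (p ^ m))) he)
    convert h using 1
    ring)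
  have hmem : Ideal.Quotient.mk (truncationIdeal p a b m n) f ∈
      Ideal.span {Ideal.Quotient.mk (truncationIdeal p a b m n)
        (C ((p : ZMod (p ^ m)) ^ (m - b + a - 1)) * X ^ (n - 1))} := by
    refine Ideal.mem_span_singleton'.mpr ⟨Ideal.Quotient.mk _ (C k), ?_⟩
    rw [← map_mul, eq_comm, Ideal.Quotient.eq]
    convert he using 1
    rw [show m - b + a - 1 = b - 1 by omega, C_mul]
    ring
  have hne : Ideal.span {Ideal.Quotient.mk (truncationIdeal p a b m n) f} ≠ ⊥ := by
    simpa only [ne_eq, Ideal.span_singleton_eq_bot] using hy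
  rw [← (hA.le_iff_eq hne).mp ((Ideal.span_singleton_le_iff_mem _).mpr hyA)]
  exact (hatom.le_iff_eq hne).mp ((Ideal.span_singleton_le_iff_mem _).mpr hmem)

end truncationIdeal

/-- Example 6.3: for a prime `p` and integers `n ≥ 2`, `0 < a < b ≤ m`, `2b - a ≥ m`, the
ring `ℤ_{p^m}[x]/⟨x^n, p^a x^{n-1} - p^b⟩` is Frobenius and local iff `2b - a = m`.
In all cases it is an artinian local ring, with a unique minimal ideal precisely when
`2b - a = m`. -/
theorem zmod_quotient_frobenius_local_iff (p : ℕ) (hp : p.Prime)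
    (a b m n : ℕ) (hn : 2 ≤ n) (ha : 0 < a) (hab : a < b) (hbm : b ≤ m)
    (hba : m ≤ 2 * b - a) :
    ((IsFrobeniusRing ((ZMod (p ^ m))[X] ⧸
        (Ideal.span {(X : (ZMod (p ^ m))[X]) ^ n,
          C ((p : ZMod (p ^ m)) ^ a) * X ^ (n - 1) - C ((p : ZMod (p ^ m)) ^ b)})) ∧
      IsLocalRing ((ZMod (p ^ m))[X] ⧸
        (Ideal.span {(X : (ZMod (p ^ m))[X]) ^ n,
          C ((p : ZMod (p ^ m)) ^ a) * X ^ (n - 1) - C ((p : ZMod (p ^ m)) ^ b)}))) ↔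
      2 * b - a = m) ∧
    IsArtinianRing ((ZMod (p ^ m))[X] ⧸
      (Ideal.span {(X : (ZMod (p ^ m))[X]) ^ n,
        C ((p : ZMod (p ^ m)) ^ a) * X ^ (n - 1) - C ((p : ZMod (p ^ m)) ^ b)})) ∧
    IsLocalRing ((ZMod (p ^ m))[X] ⧸
      (Ideal.span {(X : (ZMod (p ^ m))[X]) ^ n,
        C ((p : ZMod (p ^ m)) ^ a) * X ^ (n - 1) - C ((p : ZMod (p ^ m)) ^ b)})) ∧
    ((∃! A : Ideal ((ZMod (p ^ m))[X] ⧸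
        (Ideal.span {(X : (ZMod (p ^ m))[X]) ^ n,
          C ((p : ZMod (p ^ m)) ^ a) * X ^ (n - 1) - C ((p : ZMod (p ^ m)) ^ b)})),
        IsAtom A) ↔
      2 * b - a = m) := by
  have hartin := truncationIdeal.isArtinianRing_quotient (a := a) (b := b) (m := m) (n := n) hp
  have hlocal := truncationIdeal.isLocalRing_quotient (a := a) hp hn (by omega : 0 < b) hbm
  have hatom : (∃! A : Ideal ((ZMod (p ^ m))[X] ⧸ truncationIdeal p a b m n), IsAtom A) ↔
      2 * b - a = m :=
    ⟨truncationIdeal.eq_of_existsUnique_isAtom hp hn ha hab hbm hba,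
      truncationIdeal.existsUnique_isAtom hp hn ha hab hbm⟩
  refine ⟨?_, hartin, hlocal, hatom⟩
  rw [and_iff_left hlocal]
  exact IsLocalRing.isFrobeniusRing_iff_existsUnique_isAtom.trans hatom
end
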